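/- Let S be a finite set of pmfs with |S| = m, where all pmfs in S are on a finite set 𝒳 with |𝒳| = n. Then there exists a pmf q ∈ Γ̃(S) (i.e., q ⊑ p for every p ∈ S) with support size at most m(n−1)+1 such that (⋀S) × CGeom_{1/2,m} ⪯ q. -/

import Mathlib

open scoped ENNReal Classical
open Filter

namespace MEC

/-- A probability mass function on `α`: (nonnegative) masses summing to `1`. -/
def IsPMF {α : Type*} (p : α → ℝ≥0∞) : Prop := ∑' x, p x = 1

/-- `p` is an aggregation of `q`, written `q ⊑ p`: there is a map `g` sending the support of
`q` into the support of `p` such that `p` is the pushforward of `q` under `g`. -/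
def Agg {α β : Type*} (q : α → ℝ≥0∞) (p : β → ℝ≥0∞) : Prop :=
  ∃ g : α → β, (∀ x, q x ≠ 0 → p (g x) ≠ 0) ∧
    ∀ y, p y = ∑' x, if g x = y then q x else 0

/-- Sum of the `k` largest masses of `p`, i.e. `max_{A, |A| ≤ k} p(A)`. -/
noncomputable def topk {α : Type*} (p : α → ℝ≥0∞) (k : ℕ) : ℝ≥0∞ :=
  ⨆ (A : Finset α) (_ : A.card ≤ k), ∑ x ∈ A, p x

/-- `q` is majorized by `p`, written `q ⪯ p`: for every `k`, the sum of the `k` largest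
masses of `q` is at most the sum of the `k` largest masses of `p`. -/
def Majorized {α β : Type*} (q : α → ℝ≥0∞) (p : β → ℝ≥0∞) : Prop :=
  ∀ k : ℕ, topk q k ≤ topk p k

/-- Product pmf `(q × r)(x,z) = q(x) · r(z)`. -/
noncomputable def prodFun {α β : Type*} (q : α → ℝ≥0∞) (r : β → ℝ≥0∞) : α × β → ℝ≥0∞ :=
  fun z => q z.1 * r z.2

/-- `Geom_{1/2}` on `ℕ+ = {1,2,3,...}`, with mass `2^{-x}` at `x`. -/
noncomputable def geomHalf : ℕ+ → ℝ≥0∞ := fun x => 2⁻¹ ^ (x : ℕ)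

/-- Capped geometric distribution `CGeom_{1/2,k}` on `{1,...,k} ⊆ ℕ+`. -/
noncomputable def cgeomHalf (k : ℕ) : ℕ+ → ℝ≥0∞ := fun x =>
  if (x : ℕ) < k then 2⁻¹ ^ (x : ℕ) else if (x : ℕ) = k then 2⁻¹ ^ (k - 1) else 0

/-- `inf_{p ∈ S} max_{A ⊆ supp(p), |A| ≤ k} p(A)`. -/
noncomputable def infTopk {α : Type*} (S : Set (α → ℝ≥0∞)) (k : ℕ) : ℝ≥0∞ :=
  ⨅ p ∈ S, topk p k

/-- The greatest lower bound `⋀S` of `S` with respect to majorization, as a pmf on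
`ℕ+ = {1,2,...}`, with `(⋀S)(k) = inf_{p∈S} max_{|A|≤k} p(A) − inf_{p∈S} max_{|A|≤k−1} p(A)`. -/
noncomputable def glb {α : Type*} (S : Set (α → ℝ≥0∞)) : ℕ+ → ℝ≥0∞ :=
  fun k => infTopk S (k : ℕ) - infTopk S ((k : ℕ) - 1)

/-- Condition for the existence of `⋀S`:
`lim_{k→∞} inf_{p∈S} max_{A⊆supp(p), |A|≤k} p(A) = 1`. -/
def GlbExists {α : Type*} (S : Set (α → ℝ≥0∞)) : Prop :=
  Tendsto (fun k => infTopk S k) atTop (nhds 1)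

/-- Base-2 logarithm on `ℝ≥0∞` (intended for arguments in `[1,∞]`). -/
noncomputable def log2 (x : ℝ≥0∞) : ℝ≥0∞ :=
  if x = ∞ then ∞ else ENNReal.ofReal (Real.logb 2 x.toReal)

/-- Shannon entropy (base 2): `H(p) = Σ_x p(x) log₂ (1/p(x))`. -/
noncomputable def shannon {α : Type*} (p : α → ℝ≥0∞) : ℝ≥0∞ :=
  ∑' x, p x * log2 (p x)⁻¹

/-- Rényi entropy of order `a ∈ [0,∞]` (base 2):
`H_a(p) = (1/(1−a)) log₂ Σ_{x ∈ supp(p)} p(x)^a` for `a ∉ {1,∞}` (for `a > 1` this is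
written in the equivalent form `(1/(a−1)) log₂ (Σ_{x ∈ supp(p)} p(x)^a)⁻¹` so that it is
nonnegative), Shannon entropy for `a = 1`, and `−log₂ max_x p(x)` for `a = ∞`. -/
noncomputable def renyi {α : Type*} (p : α → ℝ≥0∞) (a : ℝ≥0∞) : ℝ≥0∞ :=
  if a = 1 then shannon p
  else if a = ∞ then log2 (⨆ x, p x)⁻¹
  else if a < 1 then log2 (∑' x, if p x = 0 then 0 else p x ^ a.toReal) * (1 - a)⁻¹
  else log2 (∑' x, if p x = 0 then 0 else p x ^ a.toReal)⁻¹ * (a - 1)⁻¹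

/-- `q ∈ Γ̃(S)`: `q` (a pmf over `ℕ`, without loss of generality) is an underlying
distribution of a coupling of `S`, i.e. `q ⊑ p` for every `p ∈ S`. -/
def UnderlyingCoupling {α : Type*} (S : Set (α → ℝ≥0∞)) (q : ℕ → ℝ≥0∞) : Prop :=
  IsPMF q ∧ ∀ p ∈ S, Agg q p

/-- `H*_a(S) = inf_{q ∈ Γ̃(S)} H_a(q)`, the minimum Rényi entropy of couplings of `S`. -/
noncomputable def minRenyi {α : Type*} (S : Set (α → ℝ≥0∞)) (a : ℝ≥0∞) : ℝ≥0∞ :=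
  ⨅ (q : ℕ → ℝ≥0∞) (_ : UnderlyingCoupling S q), renyi q a

theorem sum_le_sum_range_card {f : ℕ → ℝ} (hf : Antitone f) (B : Finset ℕ) :
    ∑ x ∈ B, f x ≤ ∑ x ∈ Finset.range B.card, f x := by
  induction B using Finset.induction_on_max with
  | empty => simp
  | insert a B hB ih =>
    have ha : a ∉ B := fun h => lt_irrefl _ (hB a h)
    rw [Finset.sum_insert ha, Finset.card_insert_of_notMem ha, Finset.sum_range_succ]
    have hc : B.card ≤ a := by
      simpa using Finset.card_le_card (fun x hx => Finset.mem_range.2 (hB x hx) : B ⊆ Finset.range a)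
    linarith [hf hc]

/-- The mass of `CGeom_{1/2,m}` outside of its `n` largest atoms. -/
noncomputable def capTail (m n : ℕ) : ℝ := if n < m then 2⁻¹ ^ n else 0

theorem capTail_nonneg (m n : ℕ) : 0 ≤ capTail m n := by
  unfold capTail; split_ifs <;> positivity

theorem residual_le_sum_capTail {ι κ : Type*} {z : κ → ℝ} (hz : ∀ j, 0 ≤ z j) (lab : ℕ → ι)
    {q R : ℕ → ℝ} (hq : ∀ t, 0 ≤ q t) (hR : ∀ t, R (t + 1) + q t ≤ R t)
    (L : Finset ι) (hL : L.Nonempty) (A : Finset ℕ) (J : Finset κ) (c : ℕ → ℕ) (n : κ → ℕ) (T : ℕ)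
    (hlab : ∀ t ∈ A, lab t ∈ L) (hT : ∀ t ∈ A, t < T)
    (hc : ∀ s ∈ A, ∀ t ∈ A, lab s = lab t → s < t → c s < c t)
    (hres : ∀ t ∈ A, ∀ E ⊆ J, E.card ≤ c t → R t ≤ ∑ j ∈ J \ E, min (z j) (q t))
    (hRT : R T ≤ ∑ j ∈ J, z j) (hn : ∑ j ∈ J, n j ≤ A.card) :
    R T ≤ ∑ j ∈ J, z j * capTail L.card (n j) := by
  have hanti : Antitone R := antitone_nat_of_succ_le fun t => by linarith [hR t, hq t]
  induction L using Finset.strongInduction generalizing A J c n T with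
  | H L IHL =>
  induction A using Finset.induction_on_max generalizing n T with
  | empty =>
    have h0 : ∀ j ∈ J, n j = 0 := by simpa using hn
    refine hRT.trans (Finset.sum_le_sum fun j hj => ?_)
    simp [h0 j hj, capTail, hL.card_pos]
  | insert t A hA IHA =>
    have htA : t ∉ A := fun h => lt_irrefl _ (hA t h)
    have htT : R T ≤ R (t + 1) := hanti (hT t (by simp))
    by_cases h1 : ∃ j ∈ J, n j ≠ 0 ∧ z j * (capTail L.card (n j - 1) - capTail L.card (n j)) ≤ q t
    · obtain ⟨j, hj, hnj, hle⟩ := h1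
      have key := IHA (Function.update n j (n j - 1)) t
        (fun s hs => hlab s (by simp [hs])) hA
        (fun s hs u hu => hc s (by simp [hs]) u (by simp [hu]))
        (fun s hs => hres s (by simp [hs]))
        ((hres t (by simp) ∅ (by simp) (by simp)).trans (by
          rw [Finset.sdiff_empty]
          exact Finset.sum_le_sum fun j _ => min_le_left _ _))
        (by
          rw [Finset.card_insert_of_notMem htA, ← Finset.add_sum_erase _ _ hj] at hn
          rw [← Finset.add_sum_erase _ _ hj, Function.update_self,
            Finset.sum_congr rfl (g := fun x => n x) (fun x hx => by
              rw [Function.update_of_ne (Finset.ne_of_mem_erase hx)])]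
          omega)
      rw [← Finset.add_sum_erase _ _ hj, Function.update_self,
        Finset.sum_congr rfl (g := fun j => z j * capTail L.card (n j)) (fun x hx => by
              rw [Function.update_of_ne (Finset.ne_of_mem_erase hx)])] at key
      rw [← Finset.add_sum_erase _ _ hj]
      linarith [hR t]
    push Not at h1
    set E := J.filter (fun j => L.card ≤ n j) with hE
    have hEJ : E ⊆ J := Finset.filter_subset _ _
    have hW : ∑ j ∈ J \ E, z j * capTail L.card (n j) ≤ ∑ j ∈ J, z j * capTail L.card (n j) :=
      Finset.sum_le_sum_of_subset_of_nonneg Finset.sdiff_subset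
        fun j _ _ => mul_nonneg (hz j) (capTail_nonneg _ _)
    have hlt : ∀ j ∈ J \ E, n j < L.card := fun j hj => by
      simp only [hE, Finset.mem_sdiff, Finset.mem_filter, not_and, not_le] at hj
      exact hj.2 hj.1
    have hmin : ∀ j ∈ J \ E, min (z j) (q t) ≤ z j * capTail L.card (n j) := fun j hj => by
      have h := hlt j hj
      by_cases h0 : n j = 0
      · rw [h0] at h ⊢
        simp [capTail, h]
      · have h2 := h1 j (Finset.mem_sdiff.1 hj).1 h0
        obtain ⟨k, hk⟩ := Nat.exists_eq_succ_of_ne_zero h0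
        have hk' : k < L.card := by omega
        rw [hk] at h h2 ⊢
        simp only [capTail, Nat.succ_eq_add_one, Nat.add_sub_cancel, h, hk', if_true, pow_succ] at h2 ⊢
        exact (min_le_right _ _).trans (by linarith)
    by_cases h2 : E.card ≤ c t + 1
    · have : R (t + 1) ≤ ∑ j ∈ J \ E, min (z j) (q t) := by
        rcases E.eq_empty_or_nonempty with h | ⟨j, hj⟩
        · rw [h]
          exact (hanti (Nat.le_succ t)).trans (hres t (by simp) ∅ (by simp) (by simp))
        · have h3 := hres t (by simp) (E.erase j) ((Finset.erase_subset _ _).trans hEJ)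
            (by rw [Finset.card_erase_of_mem hj]; omega)
          rw [Finset.sdiff_erase (hEJ hj), Finset.sum_insert (by simp [hj])] at h3
          linarith [hR t, min_le_right (z j) (q t)]
      exact htT.trans (this.trans ((Finset.sum_le_sum hmin).trans hW))
    · push Not at h2
      set A' := (insert t A).filter (fun s => lab s ≠ lab t ∧ E.card ≤ c s) with hA'
      have hA'sub : A' ⊆ insert t A := Finset.filter_subset _ _
      have hcard : (insert t A \ A').card + 1 ≤ L.card * E.card := by
        have htL : (lab t, E.card - 1) ∈ L ×ˢ Finset.range E.card := 
          Finset.mem_product.2 ⟨hlab t (by simp), Finset.mem_range.2 (by dsimp only; omega)⟩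
        have : (insert t A \ A').card ≤ ((L ×ˢ Finset.range E.card).erase (lab t, E.card - 1)).card := by
          refine Finset.card_le_card_of_injOn (fun s => (lab s, c s)) ?_ ?_
          · intro s hs
            have hs : s ∈ insert t A \ A' := hs
            rw [Finset.mem_sdiff, hA', Finset.mem_filter] at hs
            obtain ⟨hs, hs'⟩ := hs
            have : lab s = lab t → c s ≤ c t := fun h => by
              rcases Finset.mem_insert.1 hs with rfl | h'
              · exact le_rfl
              · exact (hc s hs t (by simp) h (hA s h')).le
            simp only [Finset.coe_erase, Set.mem_sdiff, Finset.mem_coe, Finset.mem_product,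
              Finset.mem_range, Set.mem_singleton_iff, Prod.mk.injEq, hlab s hs, true_and]
            by_cases h : lab s = lab t
            · have := this h
              exact ⟨by omega, by omega⟩
            · exact ⟨by by_contra h'; exact hs' ⟨hs, h, by omega⟩, fun h' => h h'.1⟩
          · intro s hs u hu h
            have hs := (Finset.mem_sdiff.1 (Finset.mem_coe.1 hs)).1
            have hu := (Finset.mem_sdiff.1 (Finset.mem_coe.1 hu)).1
            simp only [Prod.mk.injEq] at h
            rcases lt_trichotomy s u with h' | h' | h'
            · have := hc s hs u hu h.1 h'; omega
            · exact h'
            · have := hc u hu s hs h.1.symm h'; omega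
        rw [Finset.card_erase_of_mem htL, Finset.card_product, Finset.card_range] at this
        have : 0 < L.card * E.card := Nat.mul_pos hL.card_pos (by omega)
        omega
      have hcard' := Finset.card_sdiff_add_card_eq_card hA'sub
      have hnE : E.card * L.card ≤ ∑ j ∈ E, n j := by
        rw [← smul_eq_mul]
        exact Finset.card_nsmul_le_sum _ _ _ fun j hj => (Finset.mem_filter.1 hj).2
      rw [← Finset.sum_sdiff hEJ] at hn
      rw [mul_comm] at hnE
      obtain ⟨u, hu⟩ : A'.Nonempty := Finset.card_pos.1 (by omega)
      have hres' : ∀ s ∈ A', ∀ E' ⊆ J \ E, E'.card ≤ c s - E.card →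
          R s ≤ ∑ j ∈ (J \ E) \ E', min (z j) (q s) := by
        intro s hs E' hE' hc'
        have hs' := (Finset.mem_filter.1 hs).2.2
        have := hres s (hA'sub hs) (E ∪ E')
          (Finset.union_subset hEJ (hE'.trans Finset.sdiff_subset))
          ((Finset.card_union_le _ _).trans (by omega))
        rwa [← Finset.sup_eq_union, ← sdiff_sdiff_left] at this
      have htL := hlab t (by simp)
      have huL : lab u ∈ L.erase (lab t) :=
        Finset.mem_erase.2 ⟨(Finset.mem_filter.1 hu).2.1, hlab u (hA'sub hu)⟩
      have key := IHL (L.erase (lab t)) (Finset.erase_ssubset htL) ⟨_, huL⟩ A' (J \ E)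
        (fun s => c s - E.card) n T
        (fun s hs => Finset.mem_erase.2 ⟨(Finset.mem_filter.1 hs).2.1, hlab s (hA'sub hs)⟩)
        (fun s hs => hT s (hA'sub hs))
        (fun s hs v hv h h' => by
          have := hc s (hA'sub hs) v (hA'sub hv) h h'
          have := (Finset.mem_filter.1 hs).2.2
          omega)
        hres'
        ((hanti (hT u (hA'sub hu)).le).trans ((hres' u hu ∅ (by simp) (by simp)).trans (by
          rw [Finset.sdiff_empty]
          exact Finset.sum_le_sum fun j _ => min_le_left _ _)))
        (by omega)
      refine key.trans (le_trans (Finset.sum_le_sum fun j hj => ?_) hW)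
      refine mul_le_mul_of_nonneg_left ?_ (hz j)
      have h3 := hlt j hj
      have h4 := Finset.card_erase_of_mem htL
      unfold capTail
      rw [if_pos h3]
      split_ifs
      · exact le_rfl
      · positivity

theorem exists_sum_min_le_of_sum_le {X κ : Type*} [Fintype X] {p : X → ℝ} {z : κ → ℝ}
    {J : Finset κ} (hmaj : ∀ B ⊆ J, ∃ D : Finset X, D.card ≤ B.card ∧ ∑ j ∈ B, z j ≤ ∑ x ∈ D, p x)
    (hsum : ∑ x, p x = ∑ j ∈ J, z j) {s : ℝ} (hs : 0 ≤ s) {E : Finset κ} (hE : E ⊆ J) :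
    ∃ D : Finset X, D.card ≤ E.card ∧ ∑ x ∈ Dᶜ, min (p x) s ≤ ∑ j ∈ J \ E, min (z j) s := by
  set C := (J \ E).filter (fun j => s ≤ z j) with hC
  have hCJ : C ⊆ J \ E := Finset.filter_subset _ _
  have hdisj : Disjoint E C := Finset.disjoint_of_subset_right hCJ Finset.disjoint_sdiff
  have hEC : E ∪ C ⊆ J := Finset.union_subset hE (hCJ.trans Finset.sdiff_subset)
  obtain ⟨D', hD'c, hD'⟩ := hmaj (E ∪ C) hEC
  rw [Finset.card_union_of_disjoint hdisj] at hD'c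
  obtain ⟨D, hDD', hDc⟩ := Finset.exists_subset_card_eq (min_le_left D'.card E.card)
  refine ⟨D, by omega, ?_⟩
  have hD'' : D'ᶜ ⊆ Dᶜ := Finset.compl_subset_compl.2 hDD'
  have h1 : ∑ x ∈ Dᶜ, min (p x) s ≤ C.card * s + ∑ x ∈ D'ᶜ, p x := by
    rw [← Finset.sum_sdiff hD'']
    refine add_le_add ?_ (Finset.sum_le_sum fun x _ => min_le_left _ _)
    calc ∑ x ∈ Dᶜ \ D'ᶜ, min (p x) s ≤ (Dᶜ \ D'ᶜ).card • s :=
          Finset.sum_le_card_nsmul _ _ _ fun x _ => min_le_right _ _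
      _ ≤ C.card * s := by
          rw [nsmul_eq_mul]
          refine mul_le_mul_of_nonneg_right ?_ hs
          have e : Dᶜ \ D'ᶜ = D' \ D := by ext x; simp; tauto
          have := Finset.card_sdiff_add_card_eq_card hDD'
          rw [e]
          exact_mod_cast (by omega : (D' \ D).card ≤ C.card)
  have h2 : ∑ j ∈ J \ E, min (z j) s = C.card * s + ∑ j ∈ (J \ E) \ C, z j := by
    rw [← Finset.sum_sdiff hCJ, add_comm]
    congr 1
    · rw [← nsmul_eq_mul]
      exact Finset.sum_eq_card_nsmul fun j hj => min_eq_right (Finset.mem_filter.1 hj).2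
    · refine Finset.sum_congr rfl fun j hj => min_eq_left ?_
      simp only [hC, Finset.mem_sdiff, Finset.mem_filter] at hj
      by_contra h
      exact hj.2 ⟨hj.1, by linarith⟩
  have h3 := Finset.sum_add_sum_compl D' p
  have h4 := Finset.sum_sdiff (f := z) hEC
  rw [← Finset.sup_eq_union, ← sdiff_sdiff_left, Finset.sup_eq_union] at h4
  linarith

theorem sum_le_sum_min_of_touched {X : Type*} [Fintype X] {p r : X → ℝ} {s : ℝ}
    (h0 : ∀ x, 0 ≤ r x) (hrp : ∀ x, r x ≤ p x) (hs : ∀ x, r x ≤ s)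
    (htouch : ∀ x, r x < p x → ∀ y, r y ≤ p x)
    {D : Finset X} (hD : D.card ≤ (Finset.univ.filter fun x => r x = 0 ∧ 0 < p x).card) :
    ∑ x, r x ≤ ∑ x ∈ Dᶜ, min (p x) s := by
  set A := Finset.univ.filter fun x => r x = 0 ∧ 0 < p x with hA
  have hAm : ∀ x, x ∈ A ↔ r x = 0 ∧ 0 < p x := by simp [hA]
  have hcard : (D \ A).card ≤ (A \ D).card := by
    have h1 := Finset.card_sdiff_add_card_inter D A
    have h2 := Finset.card_sdiff_add_card_inter A D
    rw [Finset.inter_comm] at h2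
    omega
  have hDA : ∑ x ∈ D, r x = ∑ x ∈ D \ A, r x := by
    refine (Finset.sum_subset Finset.sdiff_subset fun x hx hx' => ?_).symm
    simp only [Finset.mem_sdiff, hx, true_and, not_not] at hx'
    exact ((hAm x).1 hx').1
  rw [← Finset.sum_add_sum_compl D]
  rcases (A \ D).eq_empty_or_nonempty with he | hne
  · rw [he, Finset.card_empty, Nat.le_zero, Finset.card_eq_zero] at hcard
    rw [hDA, hcard, Finset.sum_empty, zero_add]
    exact Finset.sum_le_sum fun x _ => le_min (hrp x) (hs x)
  · obtain ⟨a, ha, hmin⟩ := Finset.exists_min_image (A \ D) p hne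
    have hμ : ∀ y, r y ≤ min (p a) s := fun y => by
      have := (hAm a).1 (Finset.mem_sdiff.1 ha).1
      exact le_min (htouch a (by rw [this.1]; exact this.2) y) (hs y)
    have hμ0 : 0 ≤ min (p a) s := (h0 a).trans (hμ a)
    have h1 : ∑ x ∈ D, r x ≤ ∑ x ∈ Dᶜ, if x ∈ A then min (p a) s else 0 := by
      rw [hDA, ← Finset.sum_filter]
      have e : Dᶜ.filter (· ∈ A) = A \ D := by ext x; simp; tauto
      rw [e, Finset.sum_const]
      exact (Finset.sum_le_card_nsmul _ _ _ fun x _ => hμ x).trans (nsmul_le_nsmul_left hμ0 hcard)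
    refine (add_le_add_left h1 _).trans ?_
    rw [← Finset.sum_add_distrib]
    refine Finset.sum_le_sum fun x hx => ?_
    split_ifs with hxA
    · rw [((hAm x).1 hxA).1, add_zero]
      exact min_le_min_right _ (hmin x (Finset.mem_sdiff.2 ⟨hxA, Finset.mem_compl.1 hx⟩))
    · rw [zero_add]
      exact le_min (hrp x) (hs x)

/-- The run of the greedy coupling algorithm: in each step the smallest of the largest residual
masses is removed from a largest residual mass of every distribution. -/
theorem exists_greedy {ι X : Type*} [Finite ι] [Nonempty ι] [Finite X] [Nonempty X]
    (p : ι → X → ℝ) :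
    ∃ (r : ℕ → ι → X → ℝ) (g : ℕ → ι → X) (lab : ℕ → ι) (q : ℕ → ℝ),
      r 0 = p ∧ (∀ t, q t = r t (lab t) (g t (lab t))) ∧ (∀ t i x, r t i x ≤ r t i (g t i)) ∧
      (∀ t i, q t ≤ r t i (g t i)) ∧
      ∀ t i x, r (t + 1) i x = r t i x - if g t i = x then q t else 0 := by
  have h1 : ∀ r : ι → X → ℝ, ∃ g : ι → X, ∀ i x, r i x ≤ r i (g i) := fun r => by
    choose g hg using fun i => Finite.exists_max (r i)
    exact ⟨g, hg⟩
  choose g hg using h1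
  have h2 : ∀ r : ι → X → ℝ, ∃ l : ι, ∀ i, r l (g r l) ≤ r i (g r i) := fun r =>
    Finite.exists_min fun i => r i (g r i)
  choose l hl using h2
  let r : ℕ → ι → X → ℝ := fun t => Nat.rec p
    (fun _ r i x => r i x - if g r i = x then r (l r) (g r (l r)) else 0) t
  exact ⟨r, fun t => g (r t), fun t => l (r t), fun t => r t (l (r t)) (g (r t) (l (r t))),
    rfl, fun _ => rfl, fun t => hg (r t), fun t => hl (r t), fun _ _ _ => rfl⟩

theorem exists_greedy_coupling {ι X : Type*} [Fintype ι] [Nonempty ι] [Fintype X]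
    (p : ι → X → ℝ) (hp : ∀ i x, 0 ≤ p i x) (hp1 : ∀ i, ∑ x, p i x = 1) :
    ∃ (q : ℕ → ℝ) (g : ι → ℕ → X), (∀ t, 0 ≤ q t) ∧
      (∀ t, Fintype.card ι * (Fintype.card X - 1) + 1 ≤ t → q t = 0) ∧
      (∑ t ∈ Finset.range (Fintype.card ι * (Fintype.card X - 1) + 1), q t = 1) ∧
      (∀ i t, q t ≠ 0 → p i (g i t) ≠ 0) ∧
      (∀ i y, p i y = ∑ t ∈ Finset.range (Fintype.card ι * (Fintype.card X - 1) + 1),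
        if g i t = y then q t else 0) ∧
      ∀ (z : ℕ → ℝ) (J : Finset ℕ), (∀ j, 0 ≤ z j) → ∑ j ∈ J, z j = 1 →
        (∀ i, ∀ B ⊆ J, ∃ D : Finset X, D.card ≤ B.card ∧ ∑ j ∈ B, z j ≤ ∑ x ∈ D, p i x) →
        ∀ (n : ℕ → ℕ) (k : ℕ), ∑ j ∈ J, n j ≤ k →
          1 - ∑ t ∈ Finset.range k, q t ≤ ∑ j ∈ J, z j * capTail (Fintype.card ι) (n j) := by
  obtain ⟨i₀⟩ := ‹Nonempty ι›
  have hX : Nonempty X := by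
    by_contra h
    rw [not_nonempty_iff] at h
    simpa using hp1 i₀
  have : Nonempty ι := ⟨i₀⟩
  obtain ⟨r, g, lab, q, hr0, hqr, hmax, hmin, hstep⟩ := exists_greedy p
  have hnn : ∀ t i x, 0 ≤ r t i x := by
    intro t
    induction t with
    | zero => rw [hr0]; exact hp
    | succ t ih =>
      intro i x
      rw [hstep]
      split_ifs with h
      · rw [← h]; linarith [hmin t i]
      · linarith [ih i x]
  have hq : ∀ t, 0 ≤ q t := fun t => by rw [hqr]; exact hnn _ _ _
  have hanti : ∀ i x, Antitone fun t => r t i x := fun i x => antitone_nat_of_succ_le fun t => by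
    rw [hstep]; split_ifs <;> linarith [hq t]
  have hle : ∀ t i x, r t i x ≤ p i x := fun t i x => by
    rw [← hr0]; exact hanti i x (Nat.zero_le t)
  have htouch : ∀ t i x, r t i x < p i x → ∀ y, r t i y ≤ p i x := by
    intro t
    induction t with
    | zero => intro i x h; simp [hr0] at h
    | succ t ih =>
      intro i x h y
      have h' := hanti i y (Nat.le_succ t)
      dsimp only at h'
      rcases (hle t i x).lt_or_eq with h1 | h1
      · exact h'.trans (ih i x h1 y)
      · by_cases hx : g t i = x
        · rw [← h1, ← hx]; exact h'.trans (hmax t i y)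
        · rw [hstep, if_neg hx, sub_zero, h1] at h
          exact absurd h (lt_irrefl _)
  have hdecomp : ∀ t i x, p i x = (∑ s ∈ Finset.range t, if g s i = x then q s else 0) + r t i x := by
    intro t i x
    induction t with
    | zero => simp [hr0]
    | succ t ih => rw [Finset.sum_range_succ, hstep, ih]; ring
  have hR : ∀ t i, ∑ x, r t i x = 1 - ∑ s ∈ Finset.range t, q s := by
    intro t i
    have : ∑ x, p i x = (∑ s ∈ Finset.range t, q s) + ∑ x, r t i x := by
      rw [Finset.sum_congr rfl fun x _ => hdecomp t i x, Finset.sum_add_distrib, Finset.sum_comm]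
      simp
    linarith [hp1 i]
  have hzero : ∀ t, q t = 0 → 1 - ∑ s ∈ Finset.range t, q s = 0 := by
    intro t ht
    rw [← hR t (lab t)]
    refine Finset.sum_eq_zero fun x _ => le_antisymm ?_ (hnn _ _ _)
    rw [← ht, hqr]; exact hmax _ _ _
  have hzero' : ∀ t, 1 - ∑ s ∈ Finset.range t, q s = 0 → ∀ i x, r t i x = 0 := fun t ht i x =>
    (Finset.sum_eq_zero_iff_of_nonneg fun x _ => hnn t i x).1 ((hR t i).trans ht) x (by simp)
  set Z : ℕ → ι → Finset X := fun t i => Finset.univ.filter fun x => r t i x = 0 ∧ 0 < p i x with hZ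
  have hZm : ∀ t i x, x ∈ Z t i ↔ r t i x = 0 ∧ 0 < p i x := by simp [hZ]
  have hZmono : ∀ i, Monotone fun t => Z t i := fun i => monotone_nat_of_le_succ fun t x hx => by
    rw [hZm] at hx ⊢
    exact ⟨le_antisymm (hx.1 ▸ hanti i x (Nat.le_succ t)) (hnn _ _ _), hx.2⟩
  have hZlt : ∀ t, q t ≠ 0 → (Z t (lab t)).card < (Z (t + 1) (lab t)).card := by
    intro t ht
    refine Finset.card_lt_card (Finset.ssubset_iff_of_subset (hZmono _ (Nat.le_succ t)) |>.2
      ⟨g t (lab t), ?_, ?_⟩)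
    · rw [hZm, hstep, if_pos rfl, ← hqr]
      refine ⟨sub_self _, lt_of_lt_of_le ((hq t).lt_of_ne' ht) ?_⟩
      rw [hqr]; exact hle _ _ _
    · rw [hZm, ← hqr]; exact fun h => ht h.1
  have hq0 : ∀ s t, s ≤ t → q s = 0 → q t = 0 := by
    intro s t hst hs
    have := hzero' s (hzero s hs)
    refine le_antisymm ?_ (hq t)
    rw [hqr, ← this (lab t) (g t (lab t))]
    exact hanti _ _ hst
  have hcount : ∀ t, (∀ s < t, q s ≠ 0) → t ≤ ∑ i, (Z t i).card := by
    intro t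
    induction t with
    | zero => simp
    | succ t ih =>
      intro h
      refine (ih fun s hs => h s (by omega)).trans_lt ?_
      exact Finset.sum_lt_sum (fun i _ => Finset.card_le_card (hZmono i (Nat.le_succ t)))
        ⟨lab t, by simp, hZlt t (h t (by omega))⟩
  have hend : ∀ t, Fintype.card ι * (Fintype.card X - 1) + 1 ≤ t → q t = 0 := by
    intro t ht
    refine hq0 _ _ ht ?_
    by_contra hne
    set N := Fintype.card ι * (Fintype.card X - 1) + 1
    have h1 := hcount N fun s hs h => hne (hq0 s N hs.le h)
    have h2 : ∑ i, (Z N i).card ≤ ∑ i : ι, (Fintype.card X - 1) := by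
      refine Finset.sum_le_sum fun i _ => ?_
      have : (Z N i).card < Fintype.card X := by
        refine Finset.card_lt_univ_of_notMem (x := g N i) fun h => hne ?_
        rw [hZm] at h
        exact le_antisymm (h.1 ▸ hmin N i) (hq N)
      omega
    rw [Finset.sum_const, Finset.card_univ, smul_eq_mul] at h2
    omega
  have hfin := hzero _ (hend _ le_rfl)
  refine ⟨q, fun i t => g t i, hq, hend, by linarith, ?_, ?_, ?_⟩
  · intro i t ht h
    exact ht (le_antisymm (((hmin t i).trans (hle t i _)).trans h.le) (hq t))
  · intro i y
    rw [hdecomp _ i y, hzero' _ hfin, add_zero]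
  · intro z J hz hz1 hmaj n k hn
    by_cases hk : ∃ s < k, q s = 0
    · obtain ⟨s, hs, hs0⟩ := hk
      have h1 := hzero s hs0
      have h2 := Finset.sum_le_sum_of_subset_of_nonneg (Finset.range_mono hs.le)
        fun t _ _ => hq t
      have h3 : 0 ≤ ∑ j ∈ J, z j * capTail (Fintype.card ι) (n j) :=
        Finset.sum_nonneg fun j _ => mul_nonneg (hz j) (capTail_nonneg _ _)
      linarith
    · push Not at hk
      refine residual_le_sum_capTail hz lab hq
        (R := fun t => 1 - ∑ s ∈ Finset.range t, q s)
        (fun t => by rw [Finset.sum_range_succ]; linarith) Finset.univ Finset.univ_nonempty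
        (Finset.range k) J (fun t => (Z t (lab t)).card) n k (by simp) (by simp) ?_ ?_ ?_ (by simpa)
      · intro s hs t _ h hst
        rw [← h]
        exact (hZlt s (hk s (Finset.mem_range.1 hs))).trans_le
          (Finset.card_le_card (hZmono _ hst))
      · intro t _ E hE hEc
        obtain ⟨D, hDc, hD⟩ := exists_sum_min_le_of_sum_le (hmaj (lab t)) ((hp1 _).trans hz1.symm)
          (hq t) hE
        refine le_trans ?_ hD
        rw [← hR t (lab t)]
        exact sum_le_sum_min_of_touched (hnn t _) (hle t _)
          (fun x => by rw [hqr]; exact hmax _ _ _) (htouch t _) (hDc.trans hEc)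
      · rw [hz1]
        linarith [Finset.sum_nonneg fun t (_ : t ∈ Finset.range k) => hq t]

theorem sum_le_topk {α : Type*} {p : α → ℝ≥0∞} {A : Finset α} {k : ℕ} (h : A.card ≤ k) :
    ∑ x ∈ A, p x ≤ topk p k :=
  le_iSup₂_of_le A h le_rfl

theorem topk_mono {α : Type*} (p : α → ℝ≥0∞) : Monotone (topk p) := fun _ _ h =>
  iSup₂_le fun _ hA => sum_le_topk (hA.trans h)

theorem topk_zero {α : Type*} (p : α → ℝ≥0∞) : topk p 0 = 0 := by
  simp [topk]

theorem exists_topk_eq_sum {α : Type*} [Finite α] (p : α → ℝ≥0∞) (k : ℕ) :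
    ∃ D : Finset α, D.card ≤ k ∧ topk p k = ∑ x ∈ D, p x := by
  have := Fintype.ofFinite α
  obtain ⟨D, hD, hmax⟩ := Finset.exists_max_image
    (Finset.univ.filter fun A : Finset α => A.card ≤ k) (fun A => ∑ x ∈ A, p x) ⟨∅, by simp⟩
  have hDk := (Finset.mem_filter.1 hD).2
  exact ⟨D, hDk, le_antisymm (iSup₂_le fun A hA => hmax A (by simpa using hA)) (sum_le_topk hDk)⟩

theorem topk_add_topk_le {α : Type*} [Finite α] (p : α → ℝ≥0∞) (k : ℕ) :
    topk p k + topk p (k + 2) ≤ topk p (k + 1) + topk p (k + 1) := by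
  obtain ⟨B, hB, hBe⟩ := exists_topk_eq_sum p k
  obtain ⟨A, hA, hAe⟩ := exists_topk_eq_sum p (k + 2)
  rw [hBe, hAe]
  by_cases h : A.card ≤ B.card
  · exact add_le_add (sum_le_topk (by omega)) (sum_le_topk (by omega))
  · obtain ⟨x, hxA, hxB⟩ := Finset.exists_mem_notMem_of_card_lt_card (not_le.1 h)
    rw [← Finset.add_sum_erase _ _ hxA, ← add_assoc, add_comm (∑ x ∈ B, p x),
      ← Finset.sum_insert hxB]
    refine add_le_add (sum_le_topk ?_) (sum_le_topk ?_)
    · rw [Finset.card_insert_of_notMem hxB]; omega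
    · rw [Finset.card_erase_of_mem hxA]; omega

theorem topk_eq_one {α : Type*} [Fintype α] {p : α → ℝ≥0∞} (hp : IsPMF p) {k : ℕ}
    (hk : Fintype.card α ≤ k) : topk p k = 1 := by
  rw [IsPMF, tsum_fintype] at hp
  refine le_antisymm (iSup₂_le fun A _ => ?_) ?_
  · rw [← hp]
    exact Finset.sum_le_sum_of_subset (Finset.subset_univ A)
  · rw [← hp]
    exact sum_le_topk (by rwa [Finset.card_univ])

theorem exists_infTopk_eq {α : Type*} {S : Set (α → ℝ≥0∞)} (hS : S.Finite) (hne : S.Nonempty)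
    (k : ℕ) : ∃ p ∈ S, infTopk S k = topk p k := by
  obtain ⟨p, hp, hmin⟩ := Set.exists_min_image S (fun p => topk p k) hS hne
  exact ⟨p, hp, le_antisymm (iInf₂_le p hp) (le_iInf₂ hmin)⟩

theorem infTopk_mono {α : Type*} (S : Set (α → ℝ≥0∞)) : Monotone (infTopk S) := fun _ _ h =>
  iInf₂_mono fun p _ => topk_mono p h

theorem infTopk_add_infTopk_le {α : Type*} [Finite α] {S : Set (α → ℝ≥0∞)} (hS : S.Finite)
    (hne : S.Nonempty) (k : ℕ) :
    infTopk S k + infTopk S (k + 2) ≤ infTopk S (k + 1) + infTopk S (k + 1) := by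
  obtain ⟨p, hp, h⟩ := exists_infTopk_eq hS hne (k + 1)
  rw [h]
  exact (add_le_add (iInf₂_le p hp) (iInf₂_le p hp)).trans (topk_add_topk_le p k)

theorem infTopk_eq_one {α : Type*} [Fintype α] {S : Set (α → ℝ≥0∞)} (hfin : S.Finite)
    (hne : S.Nonempty) (hS : ∀ p ∈ S, IsPMF p) {k : ℕ} (hk : Fintype.card α ≤ k) :
    infTopk S k = 1 := by
  obtain ⟨p, hp, h⟩ := exists_infTopk_eq hfin hne k
  rw [h, topk_eq_one (hS p hp) hk]

theorem infTopk_ne_top {α : Type*} [Fintype α] {S : Set (α → ℝ≥0∞)} (hfin : S.Finite)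
    (hne : S.Nonempty) (hS : ∀ p ∈ S, IsPMF p) (k : ℕ) : infTopk S k ≠ ∞ := by
  have h := infTopk_mono S (le_max_left k (Fintype.card α))
  rw [infTopk_eq_one hfin hne hS (le_max_right _ _)] at h
  exact ne_top_of_le_ne_top ENNReal.one_ne_top h

theorem antitone_capTail (m : ℕ) : Antitone (capTail m) := by
  refine antitone_nat_of_succ_le fun l => ?_
  have h : (0 : ℝ) ≤ 2⁻¹ ^ l := by positivity
  unfold capTail
  rw [pow_succ]
  split_ifs <;> first | omega | linarith

theorem antitone_capTail_sub (m : ℕ) : Antitone fun l => capTail m l - capTail m (l + 1) := by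
  refine antitone_nat_of_succ_le fun l => ?_
  have h : (0 : ℝ) ≤ 2⁻¹ ^ l := by positivity
  simp only [capTail, pow_succ]
  split_ifs <;> first | omega | linarith

theorem cgeomHalf_eq_ofReal (m : ℕ) (x : ℕ+) :
    cgeomHalf m x = ENNReal.ofReal (capTail m x.natPred - capTail m (x.natPred + 1)) := by
  have hx := PNat.natPred_add_one x
  have hpow : ∀ l : ℕ, ENNReal.ofReal ((2 : ℝ)⁻¹ ^ l) = 2⁻¹ ^ l := fun l => by
    rw [ENNReal.ofReal_pow (by norm_num), ENNReal.ofReal_inv_of_pos (by norm_num)]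
    norm_num
  rw [cgeomHalf, ← hx]
  generalize x.natPred = l
  unfold capTail
  split_ifs with h1 h2 h3 h4 h5
  all_goals first | omega | skip
  · rw [← hpow, pow_succ]; congr 1; ring
  · rw [← hpow, sub_zero, ← h3]; rfl
  · simp

theorem sum_mul_capTail_sub_le {z : ℕ → ℝ} {J : Finset ℕ} (hz : ∀ j, 0 ≤ z j)
    (hzJ : ∀ j ∉ J, z j = 0) {m : ℕ} (hm : 0 < m) (A : Finset (ℕ × ℕ)) :
    ∃ n : ℕ → ℕ, ∑ j ∈ J, n j ≤ A.card ∧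
      ∑ a ∈ A, z a.1 * (capTail m a.2 - capTail m (a.2 + 1)) ≤
        ∑ j ∈ J, z j - ∑ j ∈ J, z j * capTail m (n j) := by
  set A' := A.filter fun a => a.1 ∈ J with hA'
  have hmaps : ∀ a ∈ A', a.1 ∈ J := fun a ha => (Finset.mem_filter.1 ha).2
  refine ⟨fun j => (A'.filter fun a => a.1 = j).card, ?_, ?_⟩
  · rw [← Finset.card_eq_sum_card_fiberwise hmaps]
    exact Finset.card_filter_le _ _
  · have h1 : ∑ a ∈ A, z a.1 * (capTail m a.2 - capTail m (a.2 + 1)) =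
        ∑ a ∈ A', z a.1 * (capTail m a.2 - capTail m (a.2 + 1)) := by
      refine (Finset.sum_subset (Finset.filter_subset _ _) fun a ha ha' => ?_).symm
      rw [hzJ a.1 fun h => ha' (Finset.mem_filter.2 ⟨ha, h⟩), zero_mul]
    rw [h1, ← Finset.sum_fiberwise_of_maps_to hmaps, ← Finset.sum_sub_distrib]
    refine Finset.sum_le_sum fun j _ => ?_
    have h2 : ∑ a ∈ A' with a.1 = j, z a.1 * (capTail m a.2 - capTail m (a.2 + 1)) =
        z j * ∑ l ∈ (A'.filter fun a => a.1 = j).image Prod.snd,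
          (capTail m l - capTail m (l + 1)) := by
      rw [Finset.sum_image, Finset.mul_sum]
      · exact Finset.sum_congr rfl fun a ha => by rw [(Finset.mem_filter.1 ha).2]
      · intro a ha b hb h
        exact Prod.ext (((Finset.mem_filter.1 ha).2).trans ((Finset.mem_filter.1 hb).2).symm) h
    have hinj : ((A'.filter fun a => a.1 = j).image Prod.snd).card =
        (A'.filter fun a => a.1 = j).card := by
      refine Finset.card_image_of_injOn ?_
      intro a ha b hb h
      exact Prod.ext (((Finset.mem_filter.1 ha).2).trans ((Finset.mem_filter.1 hb).2).symm) h
    have h3 := sum_le_sum_range_card (antitone_capTail_sub m)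
      ((A'.filter fun a => a.1 = j).image Prod.snd)
    rw [hinj, Finset.sum_range_sub'] at h3
    have h4 : capTail m 0 = 1 := by simp [capTail, hm]
    rw [h2]
    calc _ ≤ z j * (capTail m 0 - capTail m (A'.filter fun a => a.1 = j).card) :=
          mul_le_mul_of_nonneg_left h3 (hz j)
      _ = _ := by rw [h4]; ring

theorem majorized_prodFun_cgeomHalf {f : ℕ+ → ℝ≥0∞} {z q : ℕ → ℝ} {J : Finset ℕ}
    (hf : ∀ x, f x = ENNReal.ofReal (z x.natPred)) (hz : ∀ j, 0 ≤ z j)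
    (hzJ : ∀ j ∉ J, z j = 0) (hz1 : ∑ j ∈ J, z j = 1) {m : ℕ} (hm : 0 < m) (hq : ∀ t, 0 ≤ q t)
    (h : ∀ (n : ℕ → ℕ) (k : ℕ), ∑ j ∈ J, n j ≤ k →
      1 - ∑ t ∈ Finset.range k, q t ≤ ∑ j ∈ J, z j * capTail m (n j)) :
    Majorized (prodFun f (cgeomHalf m)) fun t => ENNReal.ofReal (q t) := by
  intro k
  refine iSup₂_le fun A hA => le_trans ?_ (sum_le_topk (A := Finset.range k) (by simp))
  have hnn : ∀ l, 0 ≤ capTail m l - capTail m (l + 1) := fun l =>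
    sub_nonneg.2 (antitone_capTail m (Nat.le_succ l))
  have hinj : Function.Injective fun a : ℕ+ × ℕ+ => (a.1.natPred, a.2.natPred) :=
    fun a b hab => Prod.ext (PNat.natPred_injective (Prod.ext_iff.1 hab).1)
      (PNat.natPred_injective (Prod.ext_iff.1 hab).2)
  obtain ⟨n, hn, hle⟩ := sum_mul_capTail_sub_le hz hzJ hm
    (A.image fun a => (a.1.natPred, a.2.natPred))
  rw [Finset.sum_image hinj.injOn, hz1] at hle
  rw [Finset.card_image_of_injective _ hinj] at hn
  rw [← ENNReal.ofReal_sum_of_nonneg fun t _ => hq t]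
  calc ∑ a ∈ A, prodFun f (cgeomHalf m) a
      = ∑ a ∈ A, ENNReal.ofReal
          (z a.1.natPred * (capTail m a.2.natPred - capTail m (a.2.natPred + 1))) :=
        Finset.sum_congr rfl fun a _ => by
          rw [prodFun, hf, cgeomHalf_eq_ofReal, ENNReal.ofReal_mul (hz _)]
    _ = ENNReal.ofReal (∑ a ∈ A,
          z a.1.natPred * (capTail m a.2.natPred - capTail m (a.2.natPred + 1))) :=
        (ENNReal.ofReal_sum_of_nonneg fun a _ => mul_nonneg (hz _) (hnn _)).symm
    _ ≤ _ := ENNReal.ofReal_le_ofReal (by linarith [h n k (hn.trans hA)])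

/-- Theorem 2: for a set `S` of `m` pmfs on a finite set `𝒳` of size `n`,
there is a pmf `q ∈ Γ̃(S)` with support size at most `m(n−1)+1` such that
`(⋀S) × CGeom_{1/2,m} ⪯ q`. -/
theorem finite_coupling (m n : ℕ) {X : Type*} [Fintype X] (hX : Fintype.card X = n)
    (S : Set (X → ℝ≥0∞)) (hcard : S.encard = m) (hS : ∀ p ∈ S, IsPMF p) :
    ∃ q : ℕ → ℝ≥0∞, IsPMF q ∧
      {x | q x ≠ 0}.encard ≤ ((m * (n - 1) + 1 : ℕ) : ℕ∞) ∧
      Majorized (prodFun (glb S) (cgeomHalf m)) q ∧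
      ∀ p ∈ S, Agg q p := by
  rcases S.eq_empty_or_nonempty with rfl | hne
  · have hm : m = 0 := by simpa using hcard.symm
    subst hm
    refine ⟨fun x => if x = 0 then 1 else 0, by simp [IsPMF], by simp, fun k => ?_, by simp⟩
    refine iSup₂_le fun A _ => ?_
    have h0 : ∀ x, cgeomHalf 0 x = 0 := fun x => by simp [cgeomHalf]
    simp [prodFun, h0]
  have hfin : S.Finite := Set.finite_of_encard_eq_coe hcard
  have := hfin.fintype
  have := hne.to_subtype
  have hcardS : Fintype.card S = m := by
    rw [← Set.toFinset_card]
    exact_mod_cast (Set.encard_eq_coe_toFinset_card S).symm.trans hcard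
  have hm : 0 < m := hcardS ▸ Fintype.card_pos
  have hsum : ∀ p ∈ S, ∑ x, p x = 1 := fun p hp => by
    simpa [IsPMF, tsum_fintype] using hS p hp
  have htop : ∀ p ∈ S, ∀ x, p x ≠ ∞ := fun p hp x =>
    ENNReal.ne_top_of_tsum_ne_top (by rw [hS p hp]; exact ENNReal.one_ne_top) x
  have hItop := infTopk_ne_top hfin hne hS
  set I : ℕ → ℝ := fun k => (infTopk S k).toReal with hI
  have hImono : Monotone I := fun a b hab => ENNReal.toReal_mono (hItop b) (infTopk_mono S hab)
  have hI0 : I 0 = 0 := by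
    obtain ⟨p, -, h⟩ := exists_infTopk_eq hfin hne 0
    simp [hI, h, topk_zero]
  have hI1 : ∀ k, n ≤ k → I k = 1 := fun k hk => by
    simp [hI, infTopk_eq_one hfin hne hS (hX.trans_le hk)]
  have hz : ∀ j, 0 ≤ I (j + 1) - I j := fun j => sub_nonneg.2 (hImono (Nat.le_succ j))
  have hzanti : Antitone fun j => I (j + 1) - I j := antitone_nat_of_succ_le fun k => by
    have h := ENNReal.toReal_mono (ENNReal.add_ne_top.2 ⟨hItop _, hItop _⟩)
      (infTopk_add_infTopk_le hfin hne k)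
    rw [ENNReal.toReal_add (hItop _) (hItop _), ENNReal.toReal_add (hItop _) (hItop _)] at h
    simp only [hI, add_assoc, one_add_one_eq_two]
    linarith
  have hz1 : ∑ j ∈ Finset.range n, (I (j + 1) - I j) = 1 := by
    rw [Finset.sum_range_sub, hI0, hI1 n le_rfl, sub_zero]
  have hglb : ∀ x : ℕ+, glb S x = ENNReal.ofReal (I (x.natPred + 1) - I x.natPred) := fun x => by
    rw [glb, PNat.natPred_add_one, ENNReal.ofReal_sub _ ENNReal.toReal_nonneg,
      ENNReal.ofReal_toReal (hItop _), ENNReal.ofReal_toReal (hItop _)]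
    rfl
  obtain ⟨q, g, hq, hend, hq1, hsupp, hagg, hmajor⟩ := exists_greedy_coupling
    (fun (p : S) x => (p.1 x).toReal) (fun _ _ => ENNReal.toReal_nonneg) (fun p => by
      rw [← ENNReal.toReal_sum fun x _ => htop p p.2 x, hsum p p.2, ENNReal.toReal_one])
  rw [hcardS, hX] at hend hq1 hagg
  rw [hcardS] at hmajor
  have htsum : ∀ P : ℕ → Prop, ∑' t, (if P t then ENNReal.ofReal (q t) else 0) =
      ENNReal.ofReal (∑ t ∈ Finset.range (m * (n - 1) + 1), if P t then q t else 0) := fun P => by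
    rw [ENNReal.ofReal_sum_of_nonneg fun t _ => by split_ifs <;> simp [hq t]]
    rw [tsum_eq_sum (s := Finset.range (m * (n - 1) + 1)) fun t ht => by
      simp [hend t (by simpa using ht)]]
    exact Finset.sum_congr rfl fun t _ => by split_ifs <;> simp
  refine ⟨fun t => ENNReal.ofReal (q t), ?_, ?_, ?_, ?_⟩
  · simpa [IsPMF, hq1] using htsum fun _ => True
  · have hsub : {x | ENNReal.ofReal (q x) ≠ 0} ⊆ (Finset.range (m * (n - 1) + 1) : Set ℕ) := by
      intro t ht
      by_contra h
      exact ht (by simp [hend t (by simpa using h)])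
    refine (Set.encard_le_encard hsub).trans ?_
    rw [Set.encard_coe_eq_coe_finsetCard, Finset.card_range]
  · refine majorized_prodFun_cgeomHalf (J := Finset.range n) hglb hz (fun j hj => ?_) hz1 hm hq
      (hmajor _ _ hz hz1 fun p B _ => ?_)
    · have hj : n ≤ j := by simpa using hj
      rw [hI1 j hj, hI1 (j + 1) (by omega), sub_self]
    · obtain ⟨D, hD, he⟩ := exists_topk_eq_sum p.1 B.card
      refine ⟨D, hD, (sum_le_sum_range_card hzanti B).trans ?_⟩
      rw [Finset.sum_range_sub, hI0, sub_zero, ← ENNReal.toReal_sum fun x _ => htop p p.2 x, ← he]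
      exact ENNReal.toReal_mono (he ▸ (ENNReal.sum_ne_top.2 fun x _ => htop p p.2 x))
        (iInf₂_le p.1 p.2)
  · intro p hp
    refine ⟨g ⟨p, hp⟩, fun t ht h => ?_, fun y => ?_⟩
    · exact hsupp ⟨p, hp⟩ t (fun h0 => ht (by simp [h0])) (by simp [h])
    · rw [htsum, ← hagg ⟨p, hp⟩ y, ENNReal.ofReal_toReal (htop p hp y)]

end MEC
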